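/- arXiv:2109.07795 — 2 statements merged into one kernel-verified Lean document; each statement's English description precedes it below -/
import Mathlib

section
/- Let M, N be weight sequences satisfying m_k^{1/k}→∞ and n_k^{1/k}→∞, and suppose C := mg(M,N) < ∞. Then h_m(t) ≤ (h_n(eCt/2))^2 for all t>0. -/
open Set Filter Topology Metric
open scoped ENNReal NNReal Topology

noncomputable section

namespace JorisPaper

/-- The sequence `m` with `m_k = M_k / k!`. -/
def lc (M : ℕ → ℝ) (k : ℕ) : ℝ := M k / (Nat.factorial k : ℝ)

/-- A weight sequence: positive, log-convex, `M_0 = 1 ≤ M_1`, `M_k^{1/k} → ∞`. -/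
structure IsWeightSeq (M : ℕ → ℝ) : Prop where
  pos : ∀ k, 0 < M k
  first : M 0 = 1
  one_le : 1 ≤ M 1
  logconvex : ∀ k, 1 ≤ k → M k ^ 2 ≤ M (k - 1) * M (k + 1)
  root : Filter.Tendsto (fun k : ℕ => M k ^ ((1 : ℝ) / (k : ℝ))) atTop atTop

/-- `m_k^{1/k} → ∞`. -/
def RootsTendsto (m : ℕ → ℝ) : Prop :=
  Filter.Tendsto (fun k : ℕ => m k ^ ((1 : ℝ) / (k : ℝ))) atTop atTop

/-- `h_m(t) = inf_k m_k t^k` for `t > 0`, and `0` for `t ≤ 0`. -/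
def hfn (m : ℕ → ℝ) (t : ℝ) : ℝ := if t ≤ 0 then 0 else ⨅ k : ℕ, m k * t ^ k

/-- `Γ̄_m(t) = min {k | h_m(t) = m_k t^k}`. -/
def GammaUpper (m : ℕ → ℝ) (t : ℝ) : ℕ := sInf {k : ℕ | hfn m t = m k * t ^ k}

/-- `Γ̲_m(t) = min {k | m_{k+1}/m_k ≥ 1/t}`. -/
def GammaLower (m : ℕ → ℝ) (t : ℝ) : ℕ := sInf {k : ℕ | 1 / t ≤ m (k + 1) / m k}

/-- `mg(M,N) = sup_{j+k ≥ 1} (M_{j+k}/(N_j N_k))^{1/(j+k)}`, as an extended real. -/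
def mg (M N : ℕ → ℝ) : ℝ≥0∞ :=
  ⨆ (j : ℕ) (k : ℕ) (_ : 1 ≤ j + k),
    ENNReal.ofReal ((M (j + k) / (N j * N k)) ^ (((j : ℝ) + (k : ℝ))⁻¹))

/-- A weight matrix: a totally ordered (pointwise) family of weight sequences. -/
structure IsWeightMatrix (W : Set (ℕ → ℝ)) : Prop where
  weight : ∀ M ∈ W, IsWeightSeq M
  ordered : ∀ M ∈ W, ∀ N ∈ W, (∀ k, M k ≤ N k) ∨ (∀ k, N k ≤ M k)

/-- R-admissible weight matrix. -/
structure RAdmissible (W : Set (ℕ → ℝ)) : Prop where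
  matrix : IsWeightMatrix W
  roots : ∀ M ∈ W, RootsTendsto (lc M)
  gamma : ∀ M ∈ W, ∃ N ∈ W, ∃ C : ℝ, 1 ≤ C ∧
    ∀ t : ℝ, 0 < t → GammaUpper (lc N) (C * t) ≤ GammaLower (lc M) t
  mgrowth : ∀ M ∈ W, ∃ N ∈ W, mg M N < ⊤

/-- B-admissible weight matrix. -/
structure BAdmissible (W : Set (ℕ → ℝ)) : Prop where
  matrix : IsWeightMatrix W
  roots : ∀ M ∈ W, RootsTendsto (lc M)
  gamma : ∀ M ∈ W, ∃ N ∈ W, ∃ C : ℝ, 1 ≤ C ∧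
    ∀ t : ℝ, 0 < t → GammaUpper (lc M) (C * t) ≤ GammaLower (lc N) t
  mgrowth : ∀ M ∈ W, ∃ N ∈ W, mg N M < ⊤

/-- `‖f‖^M_{K,ρ} < ∞` (derivatives taken within `U`). -/
def SeqBoundedOn {E F : Type*} [NormedAddCommGroup E] [NormedSpace ℝ E]
    [NormedAddCommGroup F] [NormedSpace ℝ F]
    (M : ℕ → ℝ) (ρ : ℝ) (f : E → F) (U K : Set E) : Prop :=
  ∃ C : ℝ, ∀ x ∈ K, ∀ k : ℕ, ‖iteratedFDerivWithin ℝ k f U x‖ ≤ C * ρ ^ k * M k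

/-- `f ∈ B^M_ρ(V)`: smooth on `V` with global bounds `‖f‖^M_{V,ρ} < ∞`. -/
def GlobalClass {E F : Type*} [NormedAddCommGroup E] [NormedSpace ℝ E]
    [NormedAddCommGroup F] [NormedSpace ℝ F]
    (M : ℕ → ℝ) (ρ : ℝ) (f : E → F) (V : Set E) : Prop :=
  ContDiffOn ℝ (⊤ : ℕ∞) f V ∧ SeqBoundedOn M ρ f V V

/-- The Roumieu class `E^{{W}}(U)`. -/
def Roumieu {E F : Type*} [NormedAddCommGroup E] [NormedSpace ℝ E]
    [NormedAddCommGroup F] [NormedSpace ℝ F]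
    (W : Set (ℕ → ℝ)) (U : Set E) (f : E → F) : Prop :=
  ContDiffOn ℝ (⊤ : ℕ∞) f U ∧
    ∀ K ⊆ U, IsCompact K → ∃ M ∈ W, ∃ ρ : ℝ, 0 < ρ ∧ SeqBoundedOn M ρ f U K

/-- The Beurling class `E^{(W)}(U)`. -/
def Beurling {E F : Type*} [NormedAddCommGroup E] [NormedSpace ℝ E]
    [NormedAddCommGroup F] [NormedSpace ℝ F]
    (W : Set (ℕ → ℝ)) (U : Set E) (f : E → F) : Prop :=
  ContDiffOn ℝ (⊤ : ℕ∞) f U ∧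
    ∀ K ⊆ U, IsCompact K → ∀ M ∈ W, ∀ ρ : ℝ, 0 < ρ → SeqBoundedOn M ρ f U K

/-- The open ellipse `Ω_ε` with vertices `±cosh ε` and co-vertices `±i sinh ε`. -/
def Omega (ε : ℝ) : Set ℂ :=
  {z : ℂ | (z.re / Real.cosh ε) ^ 2 + (z.im / Real.sinh ε) ^ 2 < 1}

/-- `V_U = ⋃_{x ∈ U} (x + 𝔹)`. -/
def VU {E : Type*} [NormedAddCommGroup E] [NormedSpace ℝ E] (U : Set E) : Set E :=
  ⋃ x ∈ U, Metric.closedBall x 1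

/-- A weight function in the sense of Braun–Meise–Taylor. -/
structure IsWeightFunction (ω : ℝ → ℝ) : Prop where
  cont : ContinuousOn ω (Ici 0)
  mono : MonotoneOn ω (Ici 0)
  nonneg : ∀ t, 0 ≤ t → 0 ≤ ω t
  bigO : (fun t => ω (2 * t)) =O[atTop] ω
  littleO : ω =o[atTop] (fun t => t)
  logLittleO : Real.log =o[atTop] ω
  convex : ConvexOn ℝ (Ici 0) (fun t => ω (Real.exp t))

/-- The Young conjugate `φ*_ω(s) = sup_{t ≥ 0} (s t - ω(e^t))`. -/
def youngConj (ω : ℝ → ℝ) (s : ℝ) : ℝ :=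
  sSup {y : ℝ | ∃ t : ℝ, 0 ≤ t ∧ y = s * t - ω (Real.exp t)}

/-- The Roumieu class `E^{{ω}}(U)` for a weight function `ω`. -/
def RoumieuW {E F : Type*} [NormedAddCommGroup E] [NormedSpace ℝ E]
    [NormedAddCommGroup F] [NormedSpace ℝ F]
    (ω : ℝ → ℝ) (U : Set E) (f : E → F) : Prop :=
  ContDiffOn ℝ (⊤ : ℕ∞) f U ∧
    ∀ K ⊆ U, IsCompact K → ∃ C : ℝ, 0 < C ∧ ∃ ρ : ℝ, 0 < ρ ∧
      ∀ x ∈ K, ∀ k : ℕ, ‖iteratedFDerivWithin ℝ k f U x‖ ≤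
        C * Real.exp ((1 / ρ) * youngConj ω (ρ * k))

/-- The Beurling class `E^{(ω)}(U)` for a weight function `ω`. -/
def BeurlingW {E F : Type*} [NormedAddCommGroup E] [NormedSpace ℝ E]
    [NormedAddCommGroup F] [NormedSpace ℝ F]
    (ω : ℝ → ℝ) (U : Set E) (f : E → F) : Prop :=
  ContDiffOn ℝ (⊤ : ℕ∞) f U ∧
    ∀ K ⊆ U, IsCompact K → ∀ ρ : ℝ, 0 < ρ → ∃ C : ℝ, 0 < C ∧
      ∀ x ∈ K, ∀ k : ℕ, ‖iteratedFDerivWithin ℝ k f U x‖ ≤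
        C * Real.exp ((1 / ρ) * youngConj ω (ρ * k))

/-- Each term of the supremum defining `mg` yields `M_{j+k} ≤ mg(M,N)^{j+k} N_j N_k`. -/
theorem le_mg_pow_mul {M N : ℕ → ℝ} (hM : ∀ k, 0 < M k) (hN : ∀ k, 0 < N k)
    (hmg : mg M N < ⊤) {j k : ℕ} (hjk : 1 ≤ j + k) :
    M (j + k) ≤ (mg M N).toReal ^ (j + k) * (N j * N k) := by
  have hq : 0 < M (j + k) / (N j * N k) := div_pos (hM _) (mul_pos (hN _) (hN _))
  have hle : ENNReal.ofReal ((M (j + k) / (N j * N k)) ^ (((j : ℝ) + (k : ℝ))⁻¹)) ≤ mg M N :=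
    le_iSup_of_le j (le_iSup_of_le k (le_iSup_of_le hjk le_rfl))
  have hroot := (ENNReal.ofReal_le_iff_le_toReal hmg.ne).1 hle
  have hpow := pow_le_pow_left₀ (Real.rpow_nonneg hq.le _) hroot (j + k)
  rw [← Nat.cast_add, Real.rpow_inv_natCast_pow hq.le (by omega)] at hpow
  exact (div_le_iff₀ (mul_pos (hN _) (hN _))).1 hpow

theorem mg_toReal_pos {M N : ℕ → ℝ} (hM : ∀ k, 0 < M k) (hN : ∀ k, 0 < N k)
    (hmg : mg M N < ⊤) : 0 < (mg M N).toReal := by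
  have h := le_mg_pow_mul hM hN hmg (j := 0) (k := 1) le_rfl
  rw [zero_add, pow_one] at h
  exact pos_of_mul_pos_left ((hM 1).trans_le h) (mul_pos (hN 0) (hN 1)).le

/-- `1/(2k)! ≤ (e/2)^{2k}/(k!)^2`, in multiplicative form. -/
theorem factorial_sq_le_exp_mul_factorial (k : ℕ) :
    (k.factorial : ℝ) ^ 2 ≤ (Real.exp 1 / 2) ^ (k + k) * ((k + k).factorial : ℝ) := by
  have hfac : (k.factorial : ℝ) ^ 2 ≤ ((k + k).factorial : ℝ) := by
    rw [sq]
    exact_mod_cast Nat.le_of_dvd (Nat.factorial_pos _)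
      (Nat.factorial_mul_factorial_dvd_factorial_add k k)
  have hexp : (1 : ℝ) ≤ Real.exp 1 / 2 := by
    have := Real.add_one_le_exp (1 : ℝ)
    linarith
  exact hfac.trans (le_mul_of_one_le_left (Nat.cast_nonneg _) (one_le_pow₀ hexp))

theorem lc_add_self_mul_pow_le {M N : ℕ → ℝ} {C t : ℝ} (hN : ∀ k, 0 < N k) (hC : 0 ≤ C)
    (ht : 0 ≤ t) {k : ℕ} (h : M (k + k) ≤ C ^ (k + k) * (N k * N k)) :
    lc M (k + k) * t ^ (k + k) ≤ (lc N k * (Real.exp 1 * C * t / 2) ^ k) ^ 2 := by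
  have hk : (0 : ℝ) < k.factorial := by exact_mod_cast k.factorial_pos
  have hkk : (0 : ℝ) < (k + k).factorial := by exact_mod_cast (k + k).factorial_pos
  have hleft : lc M (k + k) * t ^ (k + k) =
      M (k + k) * t ^ (k + k) / ((k + k).factorial : ℝ) := by
    rw [lc]; ring
  have hright : (lc N k * (Real.exp 1 * C * t / 2) ^ k) ^ 2 =
      C ^ (k + k) * (N k * N k) * t ^ (k + k) * (Real.exp 1 / 2) ^ (k + k) /
        (k.factorial : ℝ) ^ 2 := by
    rw [lc, show Real.exp 1 * C * t / 2 = C * t * (Real.exp 1 / 2) by ring, mul_pow, mul_pow]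
    ring
  rw [hleft, hright, div_le_div_iff₀ hkk (pow_pos hk 2), mul_assoc _ _ ((k + k).factorial : ℝ)]
  have := hN k
  exact mul_le_mul (mul_le_mul_of_nonneg_right h (by positivity))
    (factorial_sq_le_exp_mul_factorial k) (by positivity) (by positivity)

theorem lc_nonneg {M : ℕ → ℝ} (hM : ∀ k, 0 < M k) (k : ℕ) : 0 ≤ lc M k :=
  div_nonneg (hM k).le (Nat.cast_nonneg _)

/-- `h_m(t) ≤ h_n(eCt/2)^2` where `C = mg(M,N) < ∞`. -/
theorem statement7 (M N : ℕ → ℝ) (hM : IsWeightSeq M) (hN : IsWeightSeq N)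
    (hm : RootsTendsto (lc M)) (hn : RootsTendsto (lc N))
    (hmg : mg M N < ⊤) :
    ∀ t : ℝ, 0 < t →
      hfn (lc M) t ≤ hfn (lc N) (Real.exp 1 * (mg M N).toReal * t / 2) ^ 2 := by
  intro t ht
  have hC := mg_toReal_pos hM.pos hN.pos hmg
  have hs : 0 < Real.exp 1 * (mg M N).toReal * t / 2 := by positivity
  have hterm : ∀ k, 0 ≤ lc M k * t ^ k := fun k =>
    mul_nonneg (lc_nonneg hM.pos k) (pow_nonneg ht.le k)
  rw [hfn, hfn, if_neg ht.not_ge, if_neg hs.not_ge]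
  refine (Real.sqrt_le_left (Real.iInf_nonneg fun k =>
    mul_nonneg (lc_nonneg hN.pos k) (pow_nonneg hs.le k))).1 (le_ciInf fun k => ?_)
  refine (Real.sqrt_le_left (mul_nonneg (lc_nonneg hN.pos k) (pow_nonneg hs.le k))).2 ?_
  refine (ciInf_le ⟨0, forall_mem_range.2 hterm⟩ (k + k)).trans
    (lc_add_self_mul_pow_le hN.pos hC.le ht.le ?_)
  rcases k.eq_zero_or_pos with rfl | hk
  · simp [hM.first, hN.first]
  · exact le_mg_pow_mul hM.pos hN.pos hmg (by omega)

end JorisPaper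
end
end

section
/- Let U ⊆ ℝ^d be open, V_U := ⋃_{x∈U}(x+𝔹), and let f : V_U → ℂ be smooth. Let M^{(1)}, M^{(2)}, M^{(3)} be weight sequences with (m^{(i)}_k)^{1/k}→∞ for i=1,2,3, such that there exists B_1≥1 with Γ̄_{m^{(2)}}(B_1 t) ≤ Γ̲_{m^{(1)}}(t) for all t>0, and there exists B_2≥1 with m^{(2)}_{j+1} ≤ B_2^{j+1}·m^{(3)}_j for all j∈ℕ. If f ∈ B^{M^{(1)}}_{B_0}(V_U) for some B_0>0, then there exist constants K≥1, c_1, c_2 > 0 and 0 < ε_0 ≤ 1/2, and for each line segment λ ∈ Λ_U and each 0 < ε ≤ 2ε_0 a function f_{λ,ε} holomorphic on Ω_ε and continuous on the closure of Ω_ε, such that sup_{Ω_ε}|f_{λ,ε}| ≤ K and sup_{t∈[-1,1]}|f_λ(t) − f_{λ,ε}(t)| ≤ c_1·h_{m^{(3)}}(c_2·ε); the constants K, c_1, c_2, ε_0 do not depend on λ or ε. -/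
open Set Filter Topology Metric
open scoped ENNReal NNReal Topology

noncomputable section

namespace JorisPaper

lemma RootsTendsto.eventually_pow_le {m : ℕ → ℝ} (hm : RootsTendsto m) (hpos : ∀ k, 0 < m k)
    {R : ℝ} (hR : 0 ≤ R) : ∀ᶠ k : ℕ in atTop, R ^ k ≤ m k := by
  filter_upwards [hm.eventually_ge_atTop R, eventually_ge_atTop 1] with k hk hk1
  have hk0 : k ≠ 0 := by omega
  calc R ^ k ≤ (m k ^ ((1 : ℝ) / (k : ℝ))) ^ k := by gcongr
    _ = m k := by rw [one_div, Real.rpow_inv_natCast_pow (hpos k).le hk0]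

lemma IsWeightSeq.lc_pos {M : ℕ → ℝ} (hM : IsWeightSeq M) (k : ℕ) : 0 < lc M k :=
  div_pos (hM.pos k) (by positivity)

lemma IsWeightSeq.lc_zero {M : ℕ → ℝ} (hM : IsWeightSeq M) : lc M 0 = 1 := by
  simp [lc, hM.first]

lemma hfn_le {m : ℕ → ℝ} (hpos : ∀ k, 0 < m k) {t : ℝ} (ht : 0 < t) (k : ℕ) :
    hfn m t ≤ m k * t ^ k := by
  rw [hfn, if_neg ht.not_ge]
  exact ciInf_le ⟨0, by rintro _ ⟨j, rfl⟩; have := hpos j; positivity⟩ k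

lemma le_hfn {m : ℕ → ℝ} {t a : ℝ} (ht : 0 < t) (h : ∀ k, a ≤ m k * t ^ k) : a ≤ hfn m t := by
  rw [hfn, if_neg ht.not_ge]
  exact le_ciInf h

/-- The infimum defining `hfn` is attained at the index `GammaUpper`. -/
lemma hfn_eq_GammaUpper {m : ℕ → ℝ} (hm : RootsTendsto m) (hpos : ∀ k, 0 < m k) {t : ℝ}
    (ht : 0 < t) : hfn m t = m (GammaUpper m t) * t ^ GammaUpper m t := by
  suffices h : ({k : ℕ | hfn m t = m k * t ^ k}).Nonempty from Nat.sInf_mem h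
  obtain ⟨n, hn⟩ := eventually_atTop.1
    (hm.eventually_pow_le hpos (R := (m 0 + 1) / t) (by have := hpos 0; positivity))
  obtain ⟨k, -, hk⟩ := Finset.exists_min_image (Finset.range (n + 1)) (fun j => m j * t ^ j)
    ⟨0, by simp⟩
  refine ⟨k, le_antisymm (hfn_le hpos ht k) (le_hfn ht fun j => ?_)⟩
  have h0 := hpos 0
  by_cases hj : j < n + 1
  · exact hk j (by simpa using hj)
  · calc m k * t ^ k ≤ m 0 * t ^ 0 := hk 0 (by simp)
      _ ≤ (m 0 + 1) ^ j := by
        rw [pow_zero, mul_one]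
        calc m 0 ≤ m 0 + 1 := by linarith
          _ ≤ (m 0 + 1) ^ j := le_self_pow₀ (by linarith) (by omega)
      _ = ((m 0 + 1) / t) ^ j * t ^ j := by rw [← mul_pow, div_mul_cancel₀ _ ht.ne']
      _ ≤ m j * t ^ j := by gcongr; exact hn j (by omega)

/-- Up to the index `GammaLower m t` the sequence `m k * t ^ k` is decreasing. -/
lemma mul_pow_le_of_le_GammaLower {m : ℕ → ℝ} (hpos : ∀ k, 0 < m k) {t : ℝ} (ht : 0 < t)
    {k : ℕ} (hk : k ≤ GammaLower m t) : m k * t ^ k ≤ m 0 := by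
  induction k with
  | zero => simp
  | succ k ih =>
    have h : ¬ 1 / t ≤ m (k + 1) / m k := Nat.notMem_of_lt_sInf (Nat.lt_of_succ_le hk)
    rw [not_le, div_lt_div_iff₀ (hpos k) ht] at h
    calc m (k + 1) * t ^ (k + 1) = (m (k + 1) * t) * t ^ k := by ring
      _ ≤ m k * t ^ k := by gcongr; linarith
      _ ≤ m 0 := ih (by omega)

/-- The comparison of the counting functions of `m` and `n` yields a comparison of `m` with the
log-convex minorant of `n`. -/
lemma exists_forall_mul_pow_le {m n : ℕ → ℝ} (hm : ∀ k, 0 < m k) (hm0 : m 0 = 1)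
    (hn : ∀ k, 0 < n k) (hn0 : n 0 = 1) (hr : RootsTendsto n) {B : ℝ} (hB : 1 ≤ B)
    (hΓ : ∀ t : ℝ, 0 < t → GammaUpper n (B * t) ≤ GammaLower m t) (k : ℕ) :
    ∃ τ : ℝ, 0 < τ ∧ ∀ j, m k * τ ^ k ≤ n j * (B * τ) ^ j := by
  induction k with
  | zero =>
    obtain ⟨J, hJ⟩ := eventually_atTop.1 (hr.eventually_pow_le hn zero_le_one)
    have hsum : 0 ≤ ∑ j ∈ Finset.range J, (n j)⁻¹ :=
      Finset.sum_nonneg fun j _ => (inv_pos.2 (hn j)).le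
    refine ⟨1 + ∑ j ∈ Finset.range J, (n j)⁻¹, by positivity, fun j => ?_⟩
    set τ := 1 + ∑ j ∈ Finset.range J, (n j)⁻¹
    have hτ1 : 1 ≤ B * τ := one_le_mul_of_one_le_of_one_le hB (by linarith)
    rw [hm0, pow_zero, mul_one]
    rcases Nat.eq_zero_or_pos j with rfl | hj
    · simp [hn0]
    by_cases hjJ : j < J
    · have h1 : (n j)⁻¹ ≤ τ := by
        have := Finset.single_le_sum (f := fun j => (n j)⁻¹)
          (fun j _ => (inv_pos.2 (hn j)).le) (Finset.mem_range.2 hjJ)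
        linarith
      calc (1 : ℝ) = n j * (n j)⁻¹ := (mul_inv_cancel₀ (hn j).ne').symm
        _ ≤ n j * (B * τ) := by
          have := (hn j).le
          gcongr
          nlinarith
        _ ≤ n j * (B * τ) ^ j := by
          have := (hn j).le
          gcongr
          exact le_self_pow₀ hτ1 (by omega)
    · have := hJ j (by omega)
      rw [one_pow] at this
      exact one_le_mul_of_one_le_of_one_le this (one_le_pow₀ hτ1)
  | succ k ih =>
    obtain ⟨τ, hτ, h⟩ := ih
    have hk := hm k
    have hk1 := hm (k + 1)
    set t := m k / m (k + 1) with ht_def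
    have ht : 0 < t := div_pos hk hk1
    have hmt : m (k + 1) * t = m k := mul_div_cancel₀ _ hk1.ne'
    rcases le_total τ t with hle | hle
    · refine ⟨τ, hτ, fun j => le_trans ?_ (h j)⟩
      calc m (k + 1) * τ ^ (k + 1) = (m (k + 1) * τ) * τ ^ k := by ring
        _ ≤ m k * τ ^ k := by
          gcongr
          rw [← hmt]
          gcongr
    · refine ⟨t, ht, fun j => ?_⟩
      have hN : GammaUpper n (B * t) ≤ k := by
        refine (hΓ t ht).trans (Nat.sInf_le ?_)
        rw [mem_ofPred_eq, ht_def, one_div_div]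
      have hBt : 0 < B * t := by positivity
      have hatt := hfn_eq_GammaUpper hr hn hBt
      set N := GammaUpper n (B * t)
      refine le_trans ?_ (hatt ▸ hfn_le hn hBt j)
      have e : n N * (B * t) ^ N = n N * (B * τ) ^ N * (t / τ) ^ N := by
        rw [mul_assoc, ← mul_pow]
        congr 2
        field_simp
      calc m (k + 1) * t ^ (k + 1) = (m (k + 1) * t) * t ^ k := by ring
        _ = m k * τ ^ k * (t / τ) ^ k := by
          rw [hmt, mul_assoc, ← mul_pow, mul_div_cancel₀ _ hτ.ne']
        _ ≤ m k * τ ^ k * (t / τ) ^ N :=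
          mul_le_mul_of_nonneg_left
            (pow_le_pow_of_le_one (by positivity) ((div_le_one hτ).2 hle) hN) (by positivity)
        _ ≤ n N * (B * τ) ^ N * (t / τ) ^ N :=
          mul_le_mul_of_nonneg_right (h N) (by positivity)
        _ = n N * (B * t) ^ N := e.symm

lemma le_pow_mul_of_Gamma_le {m n : ℕ → ℝ} (hm : ∀ k, 0 < m k) (hm0 : m 0 = 1)
    (hn : ∀ k, 0 < n k) (hn0 : n 0 = 1) (hr : RootsTendsto n) {B : ℝ} (hB : 1 ≤ B)
    (hΓ : ∀ t : ℝ, 0 < t → GammaUpper n (B * t) ≤ GammaLower m t) (k : ℕ) :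
    m k ≤ B ^ k * n k := by
  obtain ⟨τ, hτ, h⟩ := exists_forall_mul_pow_le hm hm0 hn hn0 hr hB hΓ k
  have := h k
  rw [mul_pow, ← mul_assoc] at this
  linarith [le_of_mul_le_mul_right this (pow_pos hτ k)]

lemma two_le_GammaUpper {m : ℕ → ℝ} (hm : RootsTendsto m) (hpos : ∀ k, 0 < m k) {t : ℝ}
    (ht : 0 < t) (h1 : m 1 * t < m 0) (h2 : m 2 * t < m 1) : 2 ≤ GammaUpper m t := by
  have hatt := hfn_eq_GammaUpper hm hpos ht
  by_contra! hlt
  have : GammaUpper m t = 0 ∨ GammaUpper m t = 1 := by omega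
  rcases this with h | h <;> rw [h] at hatt
  · have := hfn_le hpos ht 1
    simp at hatt this
    linarith
  · have := hfn_le hpos ht 2
    rw [hatt] at this
    nlinarith

/-- If `m (k + 1)` is controlled by `n k`, then `h_m(t) / t` is controlled by `h_n`. -/
lemma hfn_le_mul_hfn_of_shift {m n : ℕ → ℝ} (hm : ∀ k, 0 < m k) {B : ℝ}
    (hB : 1 ≤ B) (hshift : ∀ j, m (j + 1) ≤ B ^ (j + 1) * n j) {t : ℝ} (ht : 0 < t) :
    hfn m t ≤ B * t * hfn n (B * t) := by
  have hBt : 0 < B * t := by positivity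
  rw [← div_le_iff₀' hBt]
  refine le_hfn hBt fun k => ?_
  rw [div_le_iff₀' hBt]
  calc hfn m t ≤ m (k + 1) * t ^ (k + 1) := hfn_le hm ht _
    _ ≤ (B ^ (k + 1) * n k) * t ^ (k + 1) := by gcongr; exact hshift k
    _ = B * t * (n k * (B * t) ^ k) := by ring

/-- The unnormalised Chebyshev coefficients of a function on `[-1, 1]`. -/
def chebInt (g : ℝ → ℂ) (j : ℕ) : ℂ :=
  ∫ θ in (-Real.pi)..Real.pi, ((Real.cos (j * θ) : ℝ) : ℂ) * g (Real.cos θ)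

lemma continuous_comp_cos {g : ℝ → ℂ} (hg : ContinuousOn g (Icc (-1) 1)) :
    Continuous fun θ => g (Real.cos θ) :=
  hg.comp_continuous Real.continuous_cos fun θ => Real.cos_mem_Icc θ

/-- Integration by parts: the Chebyshev coefficients of a function in terms of those of its
derivative. -/
lemma chebInt_succ {g g' : ℝ → ℂ} (hg : ∀ t ∈ Icc (-1 : ℝ) 1, HasDerivAt g (g' t) t)
    (hg' : ContinuousOn g' (Icc (-1) 1)) (j : ℕ) :
    2 * ((j : ℂ) + 1) * chebInt g (j + 1) = chebInt g' j - chebInt g' (j + 2) := by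
  have hc' := continuous_comp_cos hg'
  have hu : ∀ θ : ℝ, HasDerivAt (fun θ => g (Real.cos θ))
      (((-Real.sin θ : ℝ) : ℂ) * g' (Real.cos θ)) θ := fun θ => by
    have h := (hg _ (Real.cos_mem_Icc θ)).scomp θ (Real.hasDerivAt_cos θ)
    rw [Complex.real_smul] at h
    exact h
  have hv : ∀ θ : ℝ, HasDerivAt (fun θ : ℝ => ((Real.sin (((j + 1 : ℕ) : ℝ) * θ) : ℝ) : ℂ))
      (((((j : ℝ) + 1) * Real.cos (((j + 1 : ℕ) : ℝ) * θ) : ℝ)) : ℂ) θ := fun θ => by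
    have h1 : HasDerivAt (fun θ : ℝ => ((j + 1 : ℕ) : ℝ) * θ) ((j + 1 : ℕ) : ℝ) θ := by
      simpa using (hasDerivAt_id θ).const_mul ((j + 1 : ℕ) : ℝ)
    have h2 := h1.sin.ofReal_comp
    convert h2 using 2
    push_cast
    ring
  have hparts := intervalIntegral.integral_mul_deriv_eq_deriv_mul
    (a := -Real.pi) (b := Real.pi) (fun θ _ => hu θ) (fun θ _ => hv θ)
    ((Continuous.mul (by fun_prop) hc').intervalIntegrable _ _)
    (Continuous.intervalIntegrable (by fun_prop) _ _)
  have hpi : Real.sin (((j + 1 : ℕ) : ℝ) * Real.pi) = 0 := Real.sin_nat_mul_pi _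
  have hnpi : Real.sin (((j + 1 : ℕ) : ℝ) * -Real.pi) = 0 := by
    rw [mul_neg, Real.sin_neg, hpi, neg_zero]
  rw [hpi, hnpi] at hparts
  have e1 : ((j : ℂ) + 1) * chebInt g (j + 1) =
      ∫ θ in (-Real.pi)..Real.pi, g (Real.cos θ) *
        (((((j : ℝ) + 1) * Real.cos (((j + 1 : ℕ) : ℝ) * θ) : ℝ)) : ℂ) := by
    rw [chebInt, ← intervalIntegral.integral_const_mul]
    congr 1
    ext θ
    push_cast
    ring
  have e2 : chebInt g' j - chebInt g' (j + 2) = -(2 * ∫ θ in (-Real.pi)..Real.pi,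
      (((-Real.sin θ : ℝ) : ℂ) * g' (Real.cos θ)) *
        ((Real.sin (((j + 1 : ℕ) : ℝ) * θ) : ℝ) : ℂ)) := by
    have hi : ∀ i : ℕ, IntervalIntegrable
        (fun θ : ℝ => ((Real.cos (i * θ) : ℝ) : ℂ) * g' (Real.cos θ)) MeasureTheory.volume
        (-Real.pi) Real.pi :=
      fun i => (Continuous.mul (by fun_prop) hc').intervalIntegrable _ _
    rw [chebInt, chebInt, ← intervalIntegral.integral_sub (hi j) (hi (j + 2)),
      ← intervalIntegral.integral_const_mul, ← intervalIntegral.integral_neg]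
    congr 1
    ext θ
    have ha : Real.cos ((j : ℝ) * θ) - Real.cos (((j + 2 : ℕ) : ℝ) * θ) =
        2 * (Real.sin θ * Real.sin (((j + 1 : ℕ) : ℝ) * θ)) := by
      have h1 : (j : ℝ) * θ = ((j + 1 : ℕ) : ℝ) * θ - θ := by push_cast; ring
      have h2 : ((j + 2 : ℕ) : ℝ) * θ = ((j + 1 : ℕ) : ℝ) * θ + θ := by push_cast; ring
      rw [h1, h2, Real.cos_sub, Real.cos_add]
      ring
    rw [← sub_mul, ← Complex.ofReal_sub, ha]
    simp only [Complex.ofReal_mul, Complex.ofReal_neg, Complex.ofReal_ofNat]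
    ring
  rw [e2, mul_assoc, e1, hparts]
  simp

lemma norm_chebInt_le {g : ℝ → ℂ} {b : ℝ} (hb : ∀ t ∈ Icc (-1 : ℝ) 1, ‖g t‖ ≤ b) (j : ℕ) :
    ‖chebInt g j‖ ≤ 2 * Real.pi * b := by
  have h := intervalIntegral.norm_integral_le_of_norm_le_const (a := -Real.pi) (b := Real.pi)
    (f := fun θ => ((Real.cos (j * θ) : ℝ) : ℂ) * g (Real.cos θ)) (C := b) fun θ _ => by
      rw [norm_mul, Complex.norm_real, Real.norm_eq_abs]
      have h1 := hb _ (Real.cos_mem_Icc θ)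
      have h2 := Real.abs_cos_le_one (j * θ)
      nlinarith [norm_nonneg (g (Real.cos θ))]
  refine h.trans_eq ?_
  rw [abs_of_nonneg (by linarith [Real.pi_pos])]
  ring

/-- Decay of the Chebyshev coefficients of a function with controlled derivatives. -/
lemma norm_chebInt_mul_descFactorial_le {g : ℕ → ℝ → ℂ} {b : ℕ → ℝ}
    (hg : ∀ k, ∀ t ∈ Icc (-1 : ℝ) 1, HasDerivAt (g k) (g (k + 1) t) t)
    (hb : ∀ k, ∀ t ∈ Icc (-1 : ℝ) 1, ‖g k t‖ ≤ b k) (k i j : ℕ) :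
    ‖chebInt (g i) j‖ * (j.descFactorial k : ℝ) ≤ 2 * Real.pi * b (i + k) := by
  have hbpos : ∀ k, 0 ≤ b k := fun k => (norm_nonneg _).trans (hb k 0 (by norm_num))
  induction k generalizing i j with
  | zero => simpa using norm_chebInt_le (hb i) j
  | succ k ih =>
    cases j with
    | zero =>
      have := hbpos (i + (k + 1))
      simp only [Nat.zero_descFactorial_succ, Nat.cast_zero, mul_zero]
      positivity
    | succ j =>
      have hrec := congrArg norm (chebInt_succ (hg i)
        (fun t ht => (hg (i + 1) t ht).continuousAt.continuousWithinAt) j)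
      have hn : ‖(2 * ((j : ℂ) + 1))‖ = 2 * ((j : ℝ) + 1) := by
        rw [show (2 * ((j : ℂ) + 1)) = ((2 * ((j : ℝ) + 1) : ℝ) : ℂ) by push_cast; ring,
          Complex.norm_real, Real.norm_of_nonneg (by positivity)]
      rw [norm_mul, hn] at hrec
      have hle := hrec.le.trans (norm_sub_le _ _)
      have h1 := ih (i + 1) j
      have h2 := ih (i + 1) (j + 2)
      have hmono : (j.descFactorial k : ℝ) ≤ ((j + 2).descFactorial k : ℝ) :=
        mod_cast Nat.descFactorial_le k (by omega)
      have h3 := mul_le_mul_of_nonneg_left hmono (norm_nonneg (chebInt (g (i + 1)) (j + 2)))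
      have h4 := mul_le_mul_of_nonneg_right hle (Nat.cast_nonneg (α := ℝ) (j.descFactorial k))
      rw [Nat.succ_descFactorial_succ, show i + (k + 1) = i + 1 + k by omega]
      push_cast
      linarith

lemma norm_chebInt_mul_pow_le {g : ℕ → ℝ → ℂ} {b : ℕ → ℝ}
    (hg : ∀ k, ∀ t ∈ Icc (-1 : ℝ) 1, HasDerivAt (g k) (g (k + 1) t) t)
    (hb : ∀ k, ∀ t ∈ Icc (-1 : ℝ) 1, ‖g k t‖ ≤ b k) {k j : ℕ} (hkj : 2 * k ≤ j) :
    ‖chebInt (g 0) j‖ * ((j : ℝ) / 2) ^ k ≤ 2 * Real.pi * b k := by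
  have h := norm_chebInt_mul_descFactorial_le hg hb k 0 j
  rw [zero_add] at h
  refine le_trans ?_ h
  gcongr
  have h1 : ((j + 1 - k : ℕ) : ℝ) ^ k ≤ (j.descFactorial k : ℝ) :=
    mod_cast Nat.pow_sub_le_descFactorial j k
  refine le_trans ?_ h1
  gcongr
  rw [Nat.cast_sub (by omega)]
  have : (2 * k : ℝ) ≤ j := mod_cast hkj
  push_cast
  linarith

instance : Fact (0 < 2 * Real.pi) := ⟨Real.two_pi_pos⟩

/-- Convergence of the Chebyshev series. -/
lemma hasSum_chebInt {g : ℝ → ℂ} (hg : ContinuousOn g (Icc (-1) 1))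
    (hs : Summable fun j => ‖chebInt g j‖) (θ : ℝ) :
    HasSum (fun j : ℕ => chebInt g j / Real.pi * ((Real.cos (j * θ) : ℝ) : ℂ))
      (g (Real.cos θ) + chebInt g 0 / (2 * Real.pi)) := by
  have hc := continuous_comp_cos hg
  let G : C(AddCircle (2 * Real.pi), ℂ) :=
    ⟨fun φ : Real.Angle => g (Real.Angle.cos φ), hg.comp_continuous Real.Angle.continuous_cos
      fun φ => by
        induction φ using Real.Angle.induction_on with
        | h x => exact Real.cos_mem_Icc x⟩
  have hG : ∀ x : ℝ, G (x : AddCircle (2 * Real.pi)) = g (Real.cos x) := fun x => rfl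
  have hfour : ∀ (n : ℤ) (x : ℝ), fourier n (x : AddCircle (2 * Real.pi)) =
      ((Real.cos (n * x) : ℝ) : ℂ) + ((Real.sin (n * x) : ℝ) : ℂ) * Complex.I := fun n x => by
    rw [fourier_coe_apply]
    have hpi : (Real.pi : ℂ) ≠ 0 := mod_cast Real.pi_ne_zero
    rw [show 2 * (Real.pi : ℂ) * Complex.I * n * x / ((2 * Real.pi : ℝ) : ℂ) =
      ((n * x : ℝ) : ℂ) * Complex.I by push_cast; field_simp, Complex.exp_mul_I,
      Complex.ofReal_cos, Complex.ofReal_sin]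
  have hcoef : ∀ n : ℤ, fourierCoeff G n = chebInt g n.natAbs / (2 * Real.pi) := fun n => by
    have habs : ∀ x : ℝ, Real.cos (((-n : ℤ) : ℝ) * x) = Real.cos ((n.natAbs : ℝ) * x) := by
      intro x
      rcases Int.natAbs_eq n with h | h
      · rw [Int.cast_neg, neg_mul, Real.cos_neg]
        nth_rewrite 1 [h]
        simp
      · nth_rewrite 1 [h]
        simp
    have hodd : ∫ x in (-Real.pi)..Real.pi,
        ((Real.sin (((-n : ℤ) : ℝ) * x) : ℝ) : ℂ) * Complex.I * g (Real.cos x) = 0 := by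
      have h := intervalIntegral.integral_comp_neg (a := -Real.pi) (b := Real.pi)
        fun x => ((Real.sin (((-n : ℤ) : ℝ) * x) : ℝ) : ℂ) * Complex.I * g (Real.cos x)
      simp only [mul_neg, Real.sin_neg, Real.cos_neg, Complex.ofReal_neg, neg_mul, neg_neg,
        intervalIntegral.integral_neg] at h
      exact self_eq_neg.1 h.symm
    rw [fourierCoeff_eq_intervalIntegral _ n (-Real.pi),
      show -Real.pi + 2 * Real.pi = Real.pi by ring]
    simp only [hfour, hG, smul_eq_mul, add_mul]
    have hi : ∀ u : ℝ → ℂ, Continuous u → IntervalIntegrable (fun x => u x * g (Real.cos x))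
        MeasureTheory.volume (-Real.pi) Real.pi :=
      fun u hu => (hu.mul hc).intervalIntegrable _ _
    rw [intervalIntegral.integral_add
      (hi (fun x => ((Real.cos (((-n : ℤ) : ℝ) * x) : ℝ) : ℂ)) (by fun_prop))
      (hi (fun x => ((Real.sin (((-n : ℤ) : ℝ) * x) : ℝ) : ℂ) * Complex.I) (by fun_prop)),
      hodd, add_zero]
    simp only [habs]
    rw [chebInt, Complex.real_smul]
    push_cast
    ring
  have hsum : Summable (fourierCoeff G) := by
    refine Summable.of_norm (Summable.of_nat_of_neg ?_ ?_)
    all_goals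
      simp only [hcoef, Int.natAbs_neg, Int.natAbs_natCast, norm_div]
      exact hs.div_const _
  have h := (has_pointwise_sum_fourier_series_of_summable hsum
    (θ : AddCircle (2 * Real.pi))).nat_add_neg
  simp only [hcoef, hfour, hG, Int.natAbs_neg, Int.natAbs_natCast, smul_eq_mul] at h
  convert h using 1
  · ext j
    have hpi : (Real.pi : ℂ) ≠ 0 := mod_cast Real.pi_ne_zero
    push_cast
    rw [neg_mul, Complex.cos_neg, Complex.sin_neg]
    field_simp
    ring
  · simp

/-- Points of the ellipse are cosines of points of a horizontal strip. -/
lemma exists_cos_eq_of_mem_Omega {ε : ℝ} (hε : 0 < ε) {z : ℂ} (hz : z ∈ Omega ε) :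
    ∃ w : ℂ, Complex.cos w = z ∧ |w.im| ≤ ε := by
  obtain ⟨w, rfl⟩ := Complex.cos_surjective z
  refine ⟨w, rfl, ?_⟩
  by_contra! hlt
  have hre : (Complex.cos w).re = Real.cos w.re * Real.cosh w.im := by
    rw [Complex.cos_eq]
    simp [← Complex.ofReal_cos, ← Complex.ofReal_cosh, ← Complex.ofReal_sin, ← Complex.ofReal_sinh]
  have him : (Complex.cos w).im = -(Real.sin w.re * Real.sinh w.im) := by
    rw [Complex.cos_eq]
    simp [← Complex.ofReal_cos, ← Complex.ofReal_cosh, ← Complex.ofReal_sin, ← Complex.ofReal_sinh]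
  have hsh : 0 < Real.sinh ε := Real.sinh_pos_iff.2 hε
  have hch : 0 < Real.cosh ε := Real.cosh_pos ε
  have h1 : 1 ≤ (Real.cosh w.im / Real.cosh ε) ^ 2 := by
    refine one_le_pow₀ ((one_le_div hch).2 (Real.cosh_le_cosh.2 ?_))
    rw [abs_of_pos hε]
    exact hlt.le
  have h2 : 1 ≤ (Real.sinh w.im / Real.sinh ε) ^ 2 := by
    rw [div_pow, one_le_div (by positivity), ← sq_abs (Real.sinh w.im), Real.abs_sinh]
    gcongr
    exact Real.sinh_le_sinh.2 hlt.le
  rw [Omega, mem_ofPred_eq, hre, him] at hz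
  have e : (Real.cos w.re * Real.cosh w.im / Real.cosh ε) ^ 2 +
      (-(Real.sin w.re * Real.sinh w.im) / Real.sinh ε) ^ 2 =
      Real.cos w.re ^ 2 * (Real.cosh w.im / Real.cosh ε) ^ 2 +
        Real.sin w.re ^ 2 * (Real.sinh w.im / Real.sinh ε) ^ 2 := by ring
  rw [e] at hz
  nlinarith [Real.sin_sq_add_cos_sq w.re, sq_nonneg (Real.sin w.re), sq_nonneg (Real.cos w.re)]

lemma norm_cos_le_exp_abs_im (w : ℂ) : ‖Complex.cos w‖ ≤ Real.exp |w.im| := by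
  rw [Complex.cos, norm_div, Complex.norm_ofNat, div_le_iff₀ two_pos]
  refine (norm_add_le _ _).trans ?_
  rw [Complex.norm_exp, Complex.norm_exp]
  have h1 : (w * Complex.I).re ≤ |w.im| := by simpa using neg_le_abs w.im
  have h2 : (-w * Complex.I).re ≤ |w.im| := by simpa using le_abs_self w.im
  linarith [Real.exp_le_exp.2 h1, Real.exp_le_exp.2 h2]

lemma norm_chebyshev_eval_le {ε : ℝ} (hε : 0 < ε) {z : ℂ} (hz : z ∈ Omega ε) (j : ℕ) :
    ‖(Polynomial.Chebyshev.T ℂ j).eval z‖ ≤ Real.exp (ε * j) := by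
  obtain ⟨w, rfl, hw⟩ := exists_cos_eq_of_mem_Omega hε hz
  rw [Polynomial.Chebyshev.T_complex_cos]
  refine (norm_cos_le_exp_abs_im _).trans (Real.exp_le_exp.2 ?_)
  simp only [Int.cast_natCast, Complex.mul_im, Complex.natCast_re, Complex.natCast_im, zero_mul,
    add_zero, abs_mul, Nat.abs_cast]
  nlinarith [Nat.cast_nonneg (α := ℝ) j]

section Coefficients

/-- Decay of a sequence as expected for the Chebyshev coefficients of a function whose `k`-th
derivative is bounded by a multiple of `R ^ k * k! * m k`. -/
def CoeffBound (a : ℕ → ℝ) (D R : ℝ) (m : ℕ → ℝ) : Prop :=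
  ∀ k j : ℕ, 2 * k ≤ j → a j * ((j : ℝ) / 2) ^ k ≤ D * (R ^ k * (k.factorial * m k))

variable {a m : ℕ → ℝ} {D R : ℝ}

lemma CoeffBound.mul_pow_four_le (h : CoeffBound a D R m) (hD : 0 ≤ D) (hR : 0 < R)
    (hm : ∀ k, 0 < m k) (hm0 : m 0 = 1) (j : ℕ) :
    a j * (j : ℝ) ^ 4 ≤ D * (4096 + 384 * R ^ 4 * m 4) := by
  have h4 : 0 ≤ D * (384 * R ^ 4 * m 4) := by have := hm 4; positivity
  rcases le_or_gt 8 j with hj | hj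
  · have := h 4 j (by omega)
    norm_num [Nat.factorial, div_pow] at this
    nlinarith
  · have h0 := h 0 j (by omega)
    simp [hm0] at h0
    have hj' : (j : ℝ) ^ 4 ≤ 8 ^ 4 := by gcongr; exact_mod_cast hj.le
    have hj0 : (0 : ℝ) ≤ (j : ℝ) ^ 4 := by positivity
    nlinarith [mul_le_mul_of_nonneg_right h0 hj0, mul_le_mul_of_nonneg_left hj' hD]

/-- The basic estimate, for `k` at most an index up to which `m k * (8 * (2 * R) * ε) ^ k` is
controlled. -/
lemma CoeffBound.le_div_pow (h : CoeffBound a D R m) (hD : 0 ≤ D) (hR : 0 < R)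
    {ε H : ℝ} (hε : 0 < ε) {j k : ℕ} (hj : 1 ≤ j) (hkj : 2 * k ≤ j)
    (hH : m k * (16 * R * ε) ^ k ≤ H) (hmk : 0 < m k) :
    a j ≤ D * ((k : ℝ) / (8 * ε * j)) ^ k * H := by
  have hj' : (0 : ℝ) < j := by exact_mod_cast hj
  have h1 := h k j hkj
  rw [← le_div_iff₀ (by positivity)] at h1
  have hfac : (k.factorial : ℝ) ≤ (k : ℝ) ^ k := mod_cast Nat.factorial_le_pow k
  calc a j ≤ D * (R ^ k * (k.factorial * m k)) / ((j : ℝ) / 2) ^ k := h1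
    _ ≤ D * (R ^ k * ((k : ℝ) ^ k * m k)) / ((j : ℝ) / 2) ^ k := by gcongr
    _ = D * ((k : ℝ) / (8 * ε * j)) ^ k * (m k * (16 * R * ε) ^ k) := by
      have : (16 * R * ε) ^ k = (8 * ε) ^ k * 2 ^ k * R ^ k := by
        rw [← mul_pow, ← mul_pow]; ring
      rw [this, div_pow, div_pow, mul_pow (8 * ε)]
      field_simp
    _ ≤ D * ((k : ℝ) / (8 * ε * j)) ^ k * H := by gcongr

lemma CoeffBound.mul_exp_le (h : CoeffBound a D R m) (ha : ∀ j, 0 ≤ a j) (hD : 0 ≤ D) (hR : 0 < R)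
    (hm : ∀ k, 0 < m k) (hm0 : m 0 = 1) {ε : ℝ} (hε : 0 < ε) (hε8 : 8 * ε ≤ 1) {N : ℕ}
    (hN : ∀ k ≤ N, m k * (16 * R * ε) ^ k ≤ 1) {j : ℕ} (hj : 1 ≤ j)
    (hjN : (j : ℝ) ≤ 2 * (N / (8 * ε))) :
    a j * Real.exp (ε * j) ≤ D * (4099 + 384 * R ^ 4 * m 4) * ((j : ℝ) ^ 2)⁻¹ := by
  have hj' : (0 : ℝ) < j := by exact_mod_cast hj
  set k := ⌊2 * ε * j⌋₊
  have hk1 : (k : ℝ) ≤ 2 * ε * j := Nat.floor_le (by positivity)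
  have hk2 : 2 * ε * j < k + 1 := Nat.lt_floor_add_one _
  have hkN : k ≤ N := by
    have : (k : ℝ) ≤ N := by
      have : 2 * ε * j ≤ 2 * ε * (2 * (N / (8 * ε))) := by gcongr
      have e : 2 * ε * (2 * (N / (8 * ε))) = (N : ℝ) / 2 := by field_simp; ring
      have := Nat.cast_nonneg (α := ℝ) N
      linarith
    exact_mod_cast this
  have hkj : 2 * k ≤ j := by
    have : (2 * k : ℝ) ≤ j := by nlinarith
    exact_mod_cast this
  have h1 := h.le_div_pow hD hR hε hj hkj (hN k hkN) (hm k)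
  have hexp1 : ((k : ℝ) / (8 * ε * j)) ^ k ≤ Real.exp (-k) := by
    have e : Real.exp (-(k : ℝ)) = (Real.exp (-1)) ^ k := by rw [← Real.exp_nat_mul]; simp
    rw [e]
    gcongr
    calc (k : ℝ) / (8 * ε * j) ≤ 1 / 4 := by
          rw [div_le_div_iff₀ (by positivity) (by norm_num)]; linarith
      _ ≤ Real.exp (-1) := by
          rw [Real.exp_neg, one_div]
          exact inv_anti₀ (Real.exp_pos 1) (by linarith [Real.exp_one_lt_d9])
  have h2 : a j * Real.exp (2 * (ε * j)) ≤ 3 * D := by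
    calc a j * Real.exp (2 * (ε * j)) ≤ (D * Real.exp (-k) * 1) * Real.exp (k + 1) := by
          gcongr
          · exact h1.trans (by gcongr)
          · linarith
      _ = D * Real.exp 1 := by
          rw [mul_one, mul_assoc, ← Real.exp_add]; congr 2; ring
      _ ≤ 3 * D := by nlinarith [Real.exp_one_lt_d9]
  have h3 := h.mul_pow_four_le hD hR hm hm0 j
  have hm4 := hm 4
  rw [← div_eq_mul_inv, le_div_iff₀ (by positivity)]
  refine le_of_sq_le_sq ?_ (by positivity)
  have hnn : 0 ≤ a j * Real.exp (2 * (ε * j)) := mul_nonneg (ha j) (Real.exp_pos _).le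
  have hP : 0 ≤ D * (4096 + 384 * R ^ 4 * m 4) := by positivity
  calc (a j * Real.exp (ε * j) * (j : ℝ) ^ 2) ^ 2
      = (a j * (j : ℝ) ^ 4) * (a j * Real.exp (2 * (ε * j))) := by
        rw [two_mul, Real.exp_add]; ring
    _ ≤ (D * (4096 + 384 * R ^ 4 * m 4)) * (3 * D) := by gcongr
    _ ≤ (D * (4099 + 384 * R ^ 4 * m 4)) ^ 2 := by nlinarith

lemma CoeffBound.sum_Ico_le (h : CoeffBound a D R m) (hD : 0 ≤ D) (hR : 0 < R)
    (hm : ∀ k, 0 < m k) {ε H : ℝ} (hε : 0 < ε) (hε8 : 8 * ε ≤ 1) {N : ℕ} (hN2 : 2 ≤ N)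
    (hH : m N * (16 * R * ε) ^ N ≤ H) {J : ℕ} (hJ : 2 * (N / (8 * ε)) ≤ (J : ℝ)) (n : ℕ) :
    ∑ j ∈ Finset.Ico J n, a j ≤ D * H / (2 * ε) := by
  have hN0 : (0 : ℝ) < N := by exact_mod_cast (by omega : 0 < N)
  set x := (N : ℝ) / (8 * ε) with hx
  have hx0 : 0 < x := by positivity
  have hNx : (N : ℝ) ≤ x := by rw [hx, le_div_iff₀ (by positivity)]; nlinarith
  have hJ0 : (0 : ℝ) < J := by linarith
  have hJ1 : 1 ≤ J := by exact_mod_cast hJ0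
  have hH0 : 0 ≤ H := le_trans (by have := hm N; positivity) hH
  have hterm : ∀ j ∈ Finset.Ico J n, a j ≤ D * H * x ^ 2 * (1 / 2) ^ (N - 2) * ((j : ℝ) ^ 2)⁻¹ := by
    intro j hj
    have hJj : (J : ℝ) ≤ j := by exact_mod_cast (Finset.mem_Ico.1 hj).1
    have hj0 : (0 : ℝ) < j := by linarith
    have hNj : 2 * N ≤ j := by
      have : (2 * N : ℝ) ≤ j := by linarith
      exact_mod_cast this
    have h1 := h.le_div_pow hD hR hε (by exact_mod_cast hj0) hNj hH (hm N)
    have hq : (N : ℝ) / (8 * ε * j) = x / j := by rw [hx, div_div]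
    have hq2 : x / j ≤ 1 / 2 := by rw [div_le_div_iff₀ hj0 two_pos]; linarith
    calc a j ≤ D * (x / j) ^ N * H := by rw [← hq]; exact h1
      _ = D * ((x / j) ^ (N - 2) * (x / j) ^ 2) * H := by
        rw [← pow_add, Nat.sub_add_cancel hN2]
      _ ≤ D * ((1 / 2) ^ (N - 2) * (x / j) ^ 2) * H := by gcongr
      _ = D * H * x ^ 2 * (1 / 2) ^ (N - 2) * ((j : ℝ) ^ 2)⁻¹ := by rw [div_pow]; ring
  have hIco : Finset.Ico J n = Finset.Ioo (J - 1) n := by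
    ext i
    simp only [Finset.mem_Ico, Finset.mem_Ioo]
    omega
  have hsq : ∑ j ∈ Finset.Ico J n, ((j : ℝ) ^ 2)⁻¹ ≤ 1 / x := by
    rw [hIco]
    refine (sum_Ioo_inv_sq_le (J - 1) n).trans ?_
    rw [Nat.cast_sub hJ1, Nat.cast_one, sub_add_cancel, div_le_div_iff₀ hJ0 hx0]
    linarith
  have hpow : (N : ℝ) * (1 / 2) ^ (N - 2) ≤ 4 := by
    have h2 : (N : ℝ) ≤ 2 ^ N := by exact_mod_cast Nat.lt_two_pow_self.le
    calc (N : ℝ) * (1 / 2) ^ (N - 2) ≤ 2 ^ N * (1 / 2) ^ (N - 2) := by gcongr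
      _ = 2 ^ 2 * (2 ^ (N - 2) * (1 / 2) ^ (N - 2)) := by
        rw [← mul_assoc, ← pow_add, Nat.add_sub_cancel' hN2]
      _ = 4 := by rw [← mul_pow]; norm_num
  calc ∑ j ∈ Finset.Ico J n, a j
      ≤ ∑ j ∈ Finset.Ico J n, D * H * x ^ 2 * (1 / 2) ^ (N - 2) * ((j : ℝ) ^ 2)⁻¹ :=
        Finset.sum_le_sum hterm
    _ = D * H * x ^ 2 * (1 / 2) ^ (N - 2) * ∑ j ∈ Finset.Ico J n, ((j : ℝ) ^ 2)⁻¹ := by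
        rw [Finset.mul_sum]
    _ ≤ D * H * x ^ 2 * (1 / 2) ^ (N - 2) * (1 / x) := by gcongr
    _ = D * H * ((N : ℝ) * (1 / 2) ^ (N - 2)) / (8 * ε) := by rw [hx]; field_simp
    _ ≤ D * H * 4 / (8 * ε) := by gcongr
    _ = D * H / (2 * ε) := by field_simp; ring

lemma CoeffBound.summable (h : CoeffBound a D R m) (ha : ∀ j, 0 ≤ a j) (hD : 0 ≤ D) (hR : 0 < R)
    (hm : ∀ k, 0 < m k) (hm0 : m 0 = 1) : Summable a := by
  rw [← summable_nat_add_iff 1]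
  have hs : Summable fun j : ℕ =>
      D * (4096 + 384 * R ^ 4 * m 4) * (((j + 1 : ℕ) : ℝ) ^ 4)⁻¹ :=
    ((summable_nat_add_iff 1).2
      (Real.summable_nat_pow_inv.2 (by norm_num : 1 < 4))).mul_left _
  refine hs.of_nonneg_of_le (fun j => ha _) fun j => ?_
  rw [← div_eq_mul_inv, le_div_iff₀ (by positivity)]
  exact h.mul_pow_four_le hD hR hm hm0 (j + 1)

end Coefficients

/-- The truncated Chebyshev series of a function on `[-1, 1]`. -/
def chebApprox (g : ℝ → ℂ) (J : ℕ) (z : ℂ) : ℂ :=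
  ∑ j ∈ Finset.range J, chebInt g j / Real.pi * (Polynomial.Chebyshev.T ℂ j).eval z -
    chebInt g 0 / (2 * Real.pi)

lemma differentiable_chebApprox (g : ℝ → ℂ) (J : ℕ) : Differentiable ℂ (chebApprox g J) := by
  refine Differentiable.sub_const (Differentiable.fun_sum fun j _ => ?_) _
  exact (Polynomial.differentiable _).const_mul _

lemma norm_div_pi_le (z : ℂ) : ‖z / Real.pi‖ ≤ ‖z‖ := by
  rw [norm_div, Complex.norm_real, Real.norm_of_nonneg Real.pi_pos.le]
  exact div_le_self (norm_nonneg _) (by linarith [Real.pi_gt_three])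

lemma norm_chebApprox_le {g : ℝ → ℂ} {D P ε : ℝ} (hε : 0 < ε) {J : ℕ}
    (h0 : ‖chebInt g 0‖ ≤ D) (hP : 0 ≤ P)
    (h : ∀ j : ℕ, 1 ≤ j → j < J → ‖chebInt g j‖ * Real.exp (ε * j) ≤ P * ((j : ℝ) ^ 2)⁻¹)
    {z : ℂ} (hz : z ∈ Omega ε) : ‖chebApprox g J z‖ ≤ 2 * D + 2 * P := by
  have hD : 0 ≤ D := (norm_nonneg _).trans h0
  have hconst : ‖chebInt g 0 / (2 * Real.pi)‖ ≤ D := by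
    rw [mul_comm, ← div_div, norm_div, Complex.norm_ofNat]
    linarith [norm_div_pi_le (chebInt g 0), norm_nonneg (chebInt g 0 / Real.pi)]
  have hterm : ∀ j, ‖chebInt g j / Real.pi * (Polynomial.Chebyshev.T ℂ j).eval z‖ ≤
      ‖chebInt g j‖ * Real.exp (ε * j) := fun j => by
    rw [norm_mul]
    exact mul_le_mul (norm_div_pi_le _) (norm_chebyshev_eval_le hε hz j) (norm_nonneg _)
      (norm_nonneg _)
  have hsum : ‖∑ j ∈ Finset.range J, chebInt g j / Real.pi *
      (Polynomial.Chebyshev.T ℂ j).eval z‖ ≤ D + 2 * P := by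
    refine (norm_sum_le_of_le _ fun j _ => hterm j).trans ?_
    rcases Nat.eq_zero_or_pos J with rfl | hJ
    · simp only [Finset.range_zero, Finset.sum_empty]
      positivity
    rw [Finset.range_eq_Ico, Finset.sum_eq_sum_Ico_succ_bot hJ]
    refine add_le_add (by simpa using h0) ?_
    have hIco : Finset.Ico (0 + 1) J = Finset.Ioo 0 J := by
      ext i
      simp only [Finset.mem_Ico, Finset.mem_Ioo]
      omega
    rw [hIco]
    calc ∑ j ∈ Finset.Ioo 0 J, ‖chebInt g j‖ * Real.exp (ε * j)
        ≤ ∑ j ∈ Finset.Ioo 0 J, P * ((j : ℝ) ^ 2)⁻¹ := Finset.sum_le_sum fun j hj =>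
          h j (Finset.mem_Ioo.1 hj).1 (Finset.mem_Ioo.1 hj).2
      _ = P * ∑ j ∈ Finset.Ioo 0 J, ((j : ℝ) ^ 2)⁻¹ := by rw [Finset.mul_sum]
      _ ≤ P * 2 := by
          gcongr
          simpa using sum_Ioo_inv_sq_le (α := ℝ) 0 J
      _ = 2 * P := mul_comm _ _
  exact (norm_sub_le _ _).trans (by linarith)

lemma norm_sub_chebApprox_le {g : ℝ → ℂ} (hg : ContinuousOn g (Icc (-1) 1))
    (hs : Summable fun j => ‖chebInt g j‖) {J : ℕ} {E : ℝ}
    (hE : ∀ n, ∑ j ∈ Finset.Ico J n, ‖chebInt g j‖ ≤ E) {t : ℝ} (ht : t ∈ Icc (-1 : ℝ) 1) :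
    ‖g t - chebApprox g J t‖ ≤ E := by
  obtain ⟨θ, rfl⟩ : ∃ θ, Real.cos θ = t := ⟨_, Real.cos_arccos ht.1 ht.2⟩
  have happ : chebApprox g J (Real.cos θ : ℂ) =
      ∑ j ∈ Finset.range J, chebInt g j / Real.pi * ((Real.cos (j * θ) : ℝ) : ℂ) -
        chebInt g 0 / (2 * Real.pi) := by
    simp [chebApprox, Polynomial.Chebyshev.T_complex_cos]
  have hlim := (hasSum_chebInt hg hs θ).tendsto_sum_nat.sub_const
    (∑ j ∈ Finset.range J, chebInt g j / Real.pi * ((Real.cos (j * θ) : ℝ) : ℂ))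
  rw [happ, ← sub_add, add_comm, ← add_sub_assoc, add_comm]
  refine le_of_tendsto hlim.norm ?_
  filter_upwards [eventually_ge_atTop J] with n hn
  rw [← Finset.sum_Ico_eq_sub _ hn]
  refine (norm_sum_le_of_le _ fun j _ => ?_).trans (hE n)
  rw [norm_mul, Complex.norm_real, Real.norm_eq_abs]
  exact (mul_le_of_le_one_right (norm_nonneg _) (Real.abs_cos_le_one _)).trans (norm_div_pi_le _)

lemma isOpen_VU {E : Type*} [NormedAddCommGroup E] [NormedSpace ℝ E] {U : Set E}
    (hU : IsOpen U) : IsOpen (VU U) := by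
  rw [Metric.isOpen_iff]
  intro p hp
  simp only [VU, mem_iUnion, mem_closedBall, exists_prop] at hp
  obtain ⟨x, hx, hpx⟩ := hp
  obtain ⟨r, hr, hball⟩ := Metric.isOpen_iff.1 hU x hx
  refine ⟨r, hr, fun q hq => ?_⟩
  simp only [VU, mem_iUnion, mem_closedBall, exists_prop]
  refine ⟨x + (q - p), hball ?_, ?_⟩
  · simpa [mem_ball, dist_eq_norm] using hq
  · rw [dist_eq_norm] at hpx ⊢
    rwa [show q - (x + (q - p)) = p - x by abel]

/-- Differentiation of the iterated directional derivatives along a line. -/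
lemma hasDerivAt_iteratedFDerivWithin_line {E F : Type*} [NormedAddCommGroup E] [NormedSpace ℝ E]
    [NormedAddCommGroup F] [NormedSpace ℝ F] {f : E → F} {V : Set E} (hV : IsOpen V)
    (hf : ContDiffOn ℝ (⊤ : ℕ∞) f V) {x v : E} {t : ℝ} (ht : x + t • v ∈ V) (k : ℕ) :
    HasDerivAt (fun t : ℝ => iteratedFDerivWithin ℝ k f V (x + t • v) fun _ => v)
      (iteratedFDerivWithin ℝ (k + 1) f V (x + t • v) fun _ => v) t := by
  have h1 := ((hf.ftaylorSeriesWithin hV.uniqueDiffOn).fderivWithin k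
    (mod_cast ENat.natCast_lt_top k) _ ht).hasFDerivAt (hV.mem_nhds ht)
  have h2 : HasDerivAt (fun t : ℝ => x + t • v) v t := by
    simpa using ((hasDerivAt_id t).smul_const v).const_add x
  have h3 := (ContinuousMultilinearMap.apply ℝ (fun _ : Fin k => E) F
    (fun _ => v)).hasFDerivAt.comp_hasDerivAt t (h1.comp_hasDerivAt t h2)
  refine HasDerivAt.congr_deriv (f' := iteratedFDerivWithin ℝ (k + 1) f V (x + t • v)
    (Fin.cons v fun _ => v)) h3 ?_
  refine congrArg _ (funext fun i => ?_)
  refine Fin.cases ?_ (fun i => ?_) i <;> simp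

/-- Uniform unidirectional holomorphic approximation, part (i). -/
theorem statement9 {d : ℕ} (U : Set (EuclideanSpace ℝ (Fin d))) (hU : IsOpen U)
    (f : EuclideanSpace ℝ (Fin d) → ℂ)
    (M1 M2 M3 : ℕ → ℝ) (hM1 : IsWeightSeq M1) (hM2 : IsWeightSeq M2) (hM3 : IsWeightSeq M3)
    (hr1 : RootsTendsto (lc M1)) (hr2 : RootsTendsto (lc M2)) (hr3 : RootsTendsto (lc M3))
    (B1 : ℝ) (hB1 : 1 ≤ B1)
    (hGamma : ∀ t : ℝ, 0 < t → GammaUpper (lc M2) (B1 * t) ≤ GammaLower (lc M1) t)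
    (B2 : ℝ) (hB2 : 1 ≤ B2)
    (hshift : ∀ j : ℕ, lc M2 (j + 1) ≤ B2 ^ (j + 1) * lc M3 j)
    (B0 : ℝ) (hB0 : 0 < B0)
    (hf : GlobalClass M1 B0 f (VU U)) :
    ∃ K : ℝ, 1 ≤ K ∧ ∃ c1 : ℝ, 0 < c1 ∧ ∃ c2 : ℝ, 0 < c2 ∧
      ∃ ε0 : ℝ, 0 < ε0 ∧ ε0 ≤ 1 / 2 ∧
        ∃ F : EuclideanSpace ℝ (Fin d) → EuclideanSpace ℝ (Fin d) → ℝ → ℂ → ℂ,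
          ∀ x ∈ U, ∀ v : EuclideanSpace ℝ (Fin d), ‖v‖ = 1 →
            ∀ ε : ℝ, 0 < ε → ε ≤ 2 * ε0 →
              DifferentiableOn ℂ (F x v ε) (Omega ε) ∧
              ContinuousOn (F x v ε) (closure (Omega ε)) ∧
              (∀ z ∈ Omega ε, ‖F x v ε z‖ ≤ K) ∧
              (∀ t ∈ Icc (-1 : ℝ) 1,
                ‖f (x + t • v) - F x v ε (t : ℂ)‖ ≤ c1 * hfn (lc M3) (c2 * ε)) := by
  have hV := isOpen_VU hU
  obtain ⟨hfs, C, hC⟩ := hf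
  have hp1 := hM1.lc_pos
  have hp2 := hM2.lc_pos
  set g : EuclideanSpace ℝ (Fin d) → EuclideanSpace ℝ (Fin d) → ℕ → ℝ → ℂ :=
    fun x v k t => iteratedFDerivWithin ℝ k f (VU U) (x + t • v) fun _ => v with hg_def
  have hmem : ∀ x ∈ U, ∀ v : EuclideanSpace ℝ (Fin d), ‖v‖ = 1 → ∀ t ∈ Icc (-1 : ℝ) 1,
      x + t • v ∈ VU U := by
    intro x hx v hv t ht
    simp only [VU, mem_iUnion, exists_prop]
    refine ⟨x, hx, ?_⟩
    rw [mem_closedBall, dist_eq_norm, add_sub_cancel_left, norm_smul, hv, mul_one]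
    exact abs_le.2 ht
  have hgd : ∀ x ∈ U, ∀ v : EuclideanSpace ℝ (Fin d), ‖v‖ = 1 → ∀ k, ∀ t ∈ Icc (-1 : ℝ) 1,
      HasDerivAt (g x v k) (g x v (k + 1) t) t := fun x hx v hv k t ht =>
    hasDerivAt_iteratedFDerivWithin_line hV hfs (hmem x hx v hv t ht) k
  have hgb : ∀ x ∈ U, ∀ v : EuclideanSpace ℝ (Fin d), ‖v‖ = 1 → ∀ k, ∀ t ∈ Icc (-1 : ℝ) 1,
      ‖g x v k t‖ ≤ |C| * (B0 ^ k * (k.factorial * lc M1 k)) := by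
    intro x hx v hv k t ht
    have h1 := (iteratedFDerivWithin ℝ k f (VU U) (x + t • v)).le_opNorm fun _ => v
    simp only [hv, Finset.prod_const_one, mul_one] at h1
    have h2 := hC _ (hmem x hx v hv t ht) k
    have h3 : (k.factorial : ℝ) * lc M1 k = M1 k := mul_div_cancel₀ _ (by positivity)
    have h4 : 0 < B0 ^ k * M1 k := mul_pos (by positivity) (hM1.pos k)
    rw [h3]
    calc ‖g x v k t‖ ≤ C * B0 ^ k * M1 k := h1.trans h2
      _ = C * (B0 ^ k * M1 k) := by ring
      _ ≤ |C| * (B0 ^ k * M1 k) := by gcongr; exact le_abs_self C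
  set D := 2 * Real.pi * |C| with hD_def
  have hD : 0 ≤ D := by positivity
  have hcoef : ∀ x ∈ U, ∀ v : EuclideanSpace ℝ (Fin d), ‖v‖ = 1 →
      CoeffBound (fun j => ‖chebInt (g x v 0) j‖) D B0 (lc M1) := by
    intro x hx v hv k j hkj
    have := norm_chebInt_mul_pow_le (hgd x hx v hv) (hgb x hx v hv) hkj
    rw [hD_def, mul_assoc (2 * Real.pi)]
    exact this
  set P := D * (4099 + 384 * B0 ^ 4 * lc M1 4)
  have hP : 0 ≤ P := by have := hp1 4; positivity
  set β := 16 * B0 * B1 with hβ_def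
  have hβ : 0 < β := by positivity
  set δ := min (1 / lc M2 1) (lc M2 1 / lc M2 2) with hδ_def
  have hδ : 0 < δ := lt_min (by have := hp2 1; positivity) (div_pos (hp2 1) (hp2 2))
  refine ⟨1 + 2 * D + 2 * P, by linarith, D * B2 * β + 1, by positivity, B2 * β, by positivity,
    min (1 / 16) (δ / (4 * β)), by positivity, (min_le_left _ _).trans (by norm_num),
    fun x v ε => chebApprox (g x v 0)
      ⌈2 * ((GammaUpper (lc M2) (B1 * (16 * B0 * ε)) : ℝ) / (8 * ε))⌉₊, ?_⟩
  intro x hx v hv ε hε hεle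
  have hε8 : 8 * ε ≤ 1 := by linarith [min_le_left (1 / 16) (δ / (4 * β))]
  have ht : 0 < 16 * B0 * ε := by positivity
  have hBt : 0 < B1 * (16 * B0 * ε) := by positivity
  have hβε : B1 * (16 * B0 * ε) = β * ε := by rw [hβ_def]; ring
  have hlt : B1 * (16 * B0 * ε) < δ := by
    rw [hβε]
    have h1 : ε ≤ 2 * (δ / (4 * β)) := by linarith [min_le_right (1 / 16) (δ / (4 * β))]
    calc β * ε ≤ β * (2 * (δ / (4 * β))) := by gcongr
      _ = δ / 2 := by field_simp; ring
      _ < δ := by linarith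
  have hatt := hfn_eq_GammaUpper hr2 hp2 hBt
  have hΓ := hGamma _ ht
  have hN2 : 2 ≤ GammaUpper (lc M2) (B1 * (16 * B0 * ε)) := by
    refine two_le_GammaUpper hr2 hp2 hBt ?_ ?_
    · rw [hM2.lc_zero, mul_comm, ← lt_div_iff₀ (hp2 1)]
      exact hlt.trans_le (min_le_left _ _)
    · rw [mul_comm, ← lt_div_iff₀ (hp2 2)]
      exact hlt.trans_le (min_le_right _ _)
  set N := GammaUpper (lc M2) (B1 * (16 * B0 * ε))
  have hle1 : ∀ k ≤ N, lc M1 k * (16 * B0 * ε) ^ k ≤ 1 := fun k hk =>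
    (mul_pow_le_of_le_GammaLower hp1 ht (hk.trans hΓ)).trans_eq hM1.lc_zero
  have hleH : lc M1 N * (16 * B0 * ε) ^ N ≤ hfn (lc M2) (β * ε) := by
    rw [← hβε, hatt, mul_pow B1, ← mul_assoc]
    refine mul_le_mul_of_nonneg_right ?_ (pow_nonneg ht.le N)
    rw [mul_comm]
    exact le_pow_mul_of_Gamma_le hp1 hM1.lc_zero hp2 hM2.lc_zero hr2 hB1 hGamma N
  have hcb := hcoef x hx v hv
  refine ⟨(differentiable_chebApprox _ _).differentiableOn,
    (differentiable_chebApprox _ _).continuous.continuousOn, fun z hz => ?_, fun t ht' => ?_⟩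
  · have h0 : ‖chebInt (g x v 0) 0‖ ≤ D := by
      simpa [hM1.lc_zero] using hcb 0 0 le_rfl
    refine (norm_chebApprox_le hε h0 hP (fun j hj hjJ => ?_) hz).trans (by linarith)
    exact hcb.mul_exp_le (fun _ => norm_nonneg _) hD hB0 hp1 hM1.lc_zero hε hε8 hle1 hj
      (Nat.lt_ceil.1 hjJ).le
  · have hg0 : f (x + t • v) = g x v 0 t := by simp [hg_def]
    rw [hg0]
    have hcont : ContinuousOn (g x v 0) (Icc (-1) 1) := fun s hs =>
      (hgd x hx v hv 0 s hs).continuousAt.continuousWithinAt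
    have herr := norm_sub_chebApprox_le hcont
      (hcb.summable (fun _ => norm_nonneg _) hD hB0 hp1 hM1.lc_zero)
      (fun n => hcb.sum_Ico_le hD hB0 hp1 hε hε8 hN2 hleH (Nat.le_ceil _) n) ht'
    have hshift' := hfn_le_mul_hfn_of_shift hp2 hB2 hshift (t := β * ε) (by positivity)
    rw [← mul_assoc B2] at hshift'
    have hh : 0 ≤ hfn (lc M3) (B2 * β * ε) :=
      le_hfn (by positivity) fun k => by have := hM3.lc_pos k; positivity
    calc _ ≤ D * hfn (lc M2) (β * ε) / (2 * ε) := herr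
      _ ≤ D * (B2 * β * ε * hfn (lc M3) (B2 * β * ε)) / (2 * ε) := by gcongr
      _ = D * B2 * β / 2 * hfn (lc M3) (B2 * β * ε) := by field_simp
      _ ≤ (D * B2 * β + 1) * hfn (lc M3) (B2 * β * ε) := by
        gcongr
        have : 0 ≤ D * B2 * β := by positivity
        linarith

end JorisPaper
end
end
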